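/- For an integer $p\ge 0$ let $\phi_p:\mathbb R\to\mathbb R$ be the cardinal B-spline: $\phi_0=1$ on $[0,1)$ and $\phi_0=0$ elsewhere, and $\phi_p(t)=\frac{t}{p}\phi_{p-1}(t)+\frac{p+1-t}{p}\phi_{p-1}(t-1)$ for $p\ge 1$. For $\alpha\ge 0$ let $m$ be the positive integer with $m-1\le\alpha<m$, and let $$D_-^\alpha u(x)=\frac{1}{\Gamma(m-\alpha)}\frac{d^m}{dx^m}\int_{-\infty}^x (x-y)^{m-\alpha-1}u(y)\,dy,\qquad D_+^\alpha u(x)=\frac{(-1)^m}{\Gamma(m-\alpha)}\frac{d^m}{dx^m}\int_x^{+\infty}(y-x)^{m-\alpha-1}u(y)\,dy$$ be the left and right Riemann–Liouville fractional derivatives on the real line. Let $p\ge 2$ be an integer and let $\alpha\in[0,1)\cup(1,2]$. For $\theta\in[-\pi,\pi]$ define the symbol $$f^{p,\alpha}(\theta)=\sum_{l\in\mathbb Z}|\theta+2l\pi|^\alpha\left(\frac{\sin(\theta/2+l\pi)}{\theta/2+l\pi}\right)^{p+1}:=\lim_{N\to\infty}\sum_{l=-N}^{N}|\theta+2l\pi|^\alpha\left(\frac{\sin(\theta/2+l\pi)}{\theta/2+l\pi}\right)^{p+1},$$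 where $\frac{\sin x}{x}$ is read as $1$ at $x=0$, and $0^0=1$. This limit exists for every $\theta\in[-\pi,\pi]$, the series converges absolutely if $\alpha<p$ (that is, unless $p=\alpha=2$), and $f^{p,\alpha}$ is integrable on $[-\pi,\pi]$. Moreover, for every $k\in\mathbb Z$, the two integrals in the definitions of $D_-^\alpha\phi_p$ and $D_+^\alpha\phi_p$ are $m$ times continuously differentiable functions of $x$ near the point $\frac{p+1}{2}-k$, and $$\frac{1}{2\pi}\int_{-\pi}^{\pi} f^{p,\alpha}(\theta)\,e^{-ik\theta}\,d\theta=\frac{1}{2\cos(\pi\alpha/2)}\left(D_-^\alpha\phi_p\left(\frac{p+1}{2}-k\right)+D_+^\alpha\phi_p\left(\frac{p+1}{2}-k\right)\right).$$ -/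

import Mathlib

/-- The cardinal B-spline `φ_p`, by the Cox–de Boor recurrence. -/
noncomputable def cardinalBSpline : ℕ → ℝ → ℝ
  | 0 => fun t => if 0 ≤ t ∧ t < 1 then 1 else 0
  | (p + 1) => fun t =>
      (t / ((p : ℝ) + 1)) * cardinalBSpline p t
        + (((p : ℝ) + 2 - t) / ((p : ℝ) + 1)) * cardinalBSpline p (t - 1)

/-- The positive integer `m` with `m - 1 ≤ α < m` (for `α ≥ 0`). -/
noncomputable def rlOrder (α : ℝ) : ℕ := ⌊α⌋₊ + 1

/-- The function `z ↦ ∫_{-∞}^z (z - y)^{m-α-1} u(y) dy`. -/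
noncomputable def rlIntegralLeft (α : ℝ) (u : ℝ → ℝ) (z : ℝ) : ℝ :=
  ∫ y in Set.Iic z, (z - y) ^ ((rlOrder α : ℝ) - α - 1) * u y

/-- The function `z ↦ ∫_z^{+∞} (y - z)^{m-α-1} u(y) dy`. -/
noncomputable def rlIntegralRight (α : ℝ) (u : ℝ → ℝ) (z : ℝ) : ℝ :=
  ∫ y in Set.Ici z, (y - z) ^ ((rlOrder α : ℝ) - α - 1) * u y

/-- Left Riemann–Liouville fractional derivative of order `α ≥ 0` on the real line. -/
noncomputable def fracDerivLeft (α : ℝ) (u : ℝ → ℝ) (x : ℝ) : ℝ :=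
  (1 / Real.Gamma ((rlOrder α : ℝ) - α)) *
    iteratedDeriv (rlOrder α) (rlIntegralLeft α u) x

/-- Right Riemann–Liouville fractional derivative of order `α ≥ 0` on the real line. -/
noncomputable def fracDerivRight (α : ℝ) (u : ℝ → ℝ) (x : ℝ) : ℝ :=
  ((-1 : ℝ) ^ rlOrder α / Real.Gamma ((rlOrder α : ℝ) - α)) *
    iteratedDeriv (rlOrder α) (rlIntegralRight α u) x

/-- The `l`-th term of the series that defines the symbol; `Real.sinc x` is `sin x / x`,
with value `1` at `0`. -/
noncomputable def symbolTerm (p : ℕ) (α θ : ℝ) (l : ℤ) : ℝ :=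
  |θ + 2 * (l : ℝ) * Real.pi| ^ α * Real.sinc (θ / 2 + (l : ℝ) * Real.pi) ^ (p + 1)

/-- The symbol `f^{p,α}`. The bilateral series is the limit of the symmetric partial sums
over `-N ≤ l ≤ N`; for `α < p` it converges absolutely, for `α = p = 2` only conditionally. -/
noncomputable def fSymbol (p : ℕ) (α θ : ℝ) : ℝ :=
  ∑'[SummationFilter.symmetricIcc ℤ] l : ℤ, symbolTerm p α θ l

open MeasureTheory Set Filter Topology

/-- The truncated power `x ↦ x₊ ^ r`, with value `0` on `(-∞, 0]` also for `r = 0`. -/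
noncomputable def truncPow (r x : ℝ) : ℝ := if 0 < x then x ^ r else 0

lemma truncPow_of_pos (r : ℝ) {x : ℝ} (hx : 0 < x) : truncPow r x = x ^ r := if_pos hx

lemma truncPow_of_nonpos (r : ℝ) {x : ℝ} (hx : x ≤ 0) : truncPow r x = 0 := if_neg hx.not_gt

lemma truncPow_nonneg (r x : ℝ) : 0 ≤ truncPow r x := by
  unfold truncPow
  split_ifs with h
  · positivity
  · rfl

lemma truncPow_add_one (r x : ℝ) : truncPow (r + 1) x = x * truncPow r x := by
  rcases lt_or_ge 0 x with h | h
  · rw [truncPow_of_pos _ h, truncPow_of_pos _ h, Real.rpow_add_one h.ne', mul_comm]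
  · rw [truncPow_of_nonpos _ h, truncPow_of_nonpos _ h, mul_zero]

lemma continuous_truncPow {r : ℝ} (hr : 0 < r) : Continuous (truncPow r) := by
  have : truncPow r = fun x => (max x 0) ^ r := by
    ext x
    rcases lt_or_ge 0 x with h | h
    · rw [truncPow_of_pos _ h, max_eq_left h.le]
    · rw [truncPow_of_nonpos _ h, max_eq_right h, Real.zero_rpow hr.ne']
  rw [this]
  exact (continuous_id.max continuous_const).rpow_const fun x => Or.inr hr.le

lemma measurable_truncPow (r : ℝ) : Measurable (truncPow r) :=
  Measurable.ite measurableSet_Ioi (measurable_id.pow_const r) measurable_const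

lemma hasDerivAt_truncPow {r x : ℝ} (h : x ≠ 0 ∨ 1 < r) :
    HasDerivAt (truncPow r) (r * truncPow (r - 1) x) x := by
  rcases lt_trichotomy x 0 with hx | hx | hx
  · rw [truncPow_of_nonpos _ hx.le, mul_zero]
    refine (hasDerivAt_const x (0 : ℝ)).congr_of_eventuallyEq ?_
    filter_upwards [Iio_mem_nhds hx] with y hy using truncPow_of_nonpos _ (le_of_lt hy)
  · subst hx
    have hr : 1 < r := by simpa using h
    rw [truncPow_of_nonpos _ le_rfl, mul_zero, hasDerivAt_iff_tendsto_slope]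
    have hc := (continuous_truncPow (sub_pos.2 hr)).tendsto 0
    rw [truncPow_of_nonpos _ le_rfl] at hc
    refine (hc.mono_left nhdsWithin_le_nhds).congr' ?_
    filter_upwards [self_mem_nhdsWithin] with y hy
    have hy' : y ≠ 0 := hy
    have := truncPow_add_one (r - 1) y
    rw [sub_add_cancel] at this
    rw [slope_def_field, this, truncPow_of_nonpos _ le_rfl, sub_zero, sub_zero,
      mul_div_cancel_left₀ _ hy']
  · rw [truncPow_of_pos _ hx]
    refine (Real.hasDerivAt_rpow_const (Or.inl hx.ne')).congr_of_eventuallyEq ?_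
    filter_upwards [Ioi_mem_nhds hx] with y hy using truncPow_of_pos _ hy

lemma truncPow_contDiffOn_and_iteratedDeriv (n : ℕ) {r : ℝ} {U : Set ℝ} (hU : IsOpen U)
    (hn : (n : ℝ) ≤ r) (h : 0 ∉ U ∨ (n : ℝ) < r) :
    ContDiffOn ℝ n (truncPow r) U ∧ ∀ x ∈ U, iteratedDeriv n (truncPow r) x =
      Real.Gamma (r + 1) / Real.Gamma (r + 1 - n) * truncPow (r - n) x := by
  induction n generalizing r with
  | zero =>
    have hr : 0 ≤ r := by simpa using hn
    constructor
    · simp only [Nat.cast_zero] at h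
      refine contDiffOn_zero.2 ?_
      rcases h with h | h
      · intro x hx
        have hx0 : x ≠ 0 := fun h0 => h (h0 ▸ hx)
        exact (hasDerivAt_truncPow (Or.inl hx0)).continuousAt.continuousWithinAt
      · exact (continuous_truncPow h).continuousOn
    · intro x _
      have : Real.Gamma (r + 1) ≠ 0 := (Real.Gamma_pos_of_pos (by linarith)).ne'
      simp [div_self this]
  | succ n ih =>
    push_cast at hn h
    have hn' : (n : ℝ) ≤ r - 1 := by linarith
    obtain ⟨ih1, ih2⟩ := ih hn' (h.imp_right fun h => by linarith)
    have hd : ∀ x ∈ U, HasDerivAt (truncPow r) (r * truncPow (r - 1) x) x := by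
      intro x hx
      refine hasDerivAt_truncPow (h.imp (fun h h0 => h (h0 ▸ hx)) fun h => ?_)
      have : (0 : ℝ) ≤ n := n.cast_nonneg
      linarith
    constructor
    · have hc := (contDiffOn_succ_iff_deriv_of_isOpen (𝕜 := ℝ) (n := (n : WithTop ℕ∞))
        (f := truncPow r) hU).2
      refine hc ⟨fun x hx => (hd x hx).differentiableAt.differentiableWithinAt, by simp, ?_⟩
      exact (contDiffOn_const.mul ih1).congr fun x hx => (hd x hx).deriv
    · intro x hx
      have he : deriv (truncPow r) =ᶠ[𝓝 x] fun y => r * truncPow (r - 1) y := by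
        filter_upwards [hU.mem_nhds hx] with y hy using (hd y hy).deriv
      have h0 : r ≠ 0 := by
        have : (0 : ℝ) ≤ n := n.cast_nonneg
        linarith
      rw [iteratedDeriv_succ', he.iteratedDeriv_eq, iteratedDeriv_const_mul_field, ih2 x hx,
        Real.Gamma_add_one h0]
      push_cast
      rw [sub_add_cancel, show r + 1 - (n + 1) = r - n by ring,
        show r - (n + 1) = r - 1 - n by ring]
      ring

lemma integral_Iic_mul_truncPow {β s : ℝ} (hβ : 0 < β) (hs : -1 < s) (a z : ℝ) :
    IntegrableOn (fun y => (z - y) ^ (β - 1) * truncPow s (y - a)) (Iic z) ∧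
    ∫ y in Iic z, (z - y) ^ (β - 1) * truncPow s (y - a) =
      Real.Gamma β * Real.Gamma (s + 1) / Real.Gamma (s + 1 + β) * truncPow (s + β) (z - a) := by
  rcases le_or_gt z a with hza | hza
  · have h0 : EqOn (fun y => (z - y) ^ (β - 1) * truncPow s (y - a)) (fun _ => 0) (Iic z) := by
      intro y hy
      have : y ≤ z := hy
      simp only
      rw [truncPow_of_nonpos s (by linarith), mul_zero]
    refine ⟨integrableOn_zero.congr_fun h0.symm measurableSet_Iic, ?_⟩
    rw [setIntegral_congr_fun measurableSet_Iic h0, truncPow_of_nonpos _ (by linarith)]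
    simp
  · have hL : 0 < z - a := sub_pos.2 hza
    have hpos : 0 < Real.Gamma β * Real.Gamma (s + 1) / Real.Gamma (s + 1 + β) *
        truncPow (s + β) (z - a) := by
      rw [truncPow_of_pos _ hL]
      have := Real.Gamma_pos_of_pos hβ
      have := Real.Gamma_pos_of_pos (show 0 < s + 1 by linarith)
      have := Real.Gamma_pos_of_pos (show 0 < s + 1 + β by linarith)
      positivity
    suffices hI : ∫ y in Iic z, (z - y) ^ (β - 1) * truncPow s (y - a) =
      Real.Gamma β * Real.Gamma (s + 1) / Real.Gamma (s + 1 + β) * truncPow (s + β) (z - a) by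
      refine ⟨?_, hI⟩
      by_contra hni
      rw [integral_undef hni] at hI
      exact hpos.ne hI
    have h1 : ∫ y in Iic z, (z - y) ^ (β - 1) * truncPow s (y - a) =
        ∫ y in Ioc a z, (z - y) ^ (β - 1) * (y - a) ^ s := by
      rw [← Iic_union_Ioc_eq_Iic hza.le]
      rw [setIntegral_eq_of_subset_of_forall_sdiff_eq_zero (s := Ioc a z)
        (measurableSet_Iic.union measurableSet_Ioc) subset_union_right]
      · refine setIntegral_congr_fun measurableSet_Ioc fun y hy => ?_
        rw [truncPow_of_pos _ (sub_pos.2 hy.1)]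
      · rintro y ⟨hy | hy, hy'⟩
        · have : y ≤ a := hy
          rw [truncPow_of_nonpos _ (by linarith), mul_zero]
        · exact absurd hy hy'
    have h2 : ∫ y in Ioc a z, (z - y) ^ (β - 1) * (y - a) ^ s =
        ∫ x in (0 : ℝ)..(z - a), x ^ s * ((z - a) - x) ^ (β - 1) := by
      rw [← intervalIntegral.integral_of_le hza.le]
      have := intervalIntegral.integral_comp_sub_right (a := a) (b := z)
        (fun x => x ^ s * ((z - a) - x) ^ (β - 1)) a
      rw [sub_self] at this
      rw [← this]
      refine intervalIntegral.integral_congr fun y _ => ?_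
      rw [show z - a - (y - a) = z - y by ring, mul_comm]
    have h3 := Complex.betaIntegral_scaled ((s + 1 : ℝ) : ℂ) (β : ℂ) hL
    rw [Complex.betaIntegral_eq_Gamma_mul_div _ _ (by simpa using by linarith) (by simpa using hβ)]
      at h3
    rw [h1, h2, truncPow_of_pos _ hL]
    apply Complex.ofReal_injective
    rw [← intervalIntegral.integral_ofReal]
    have h4 : ∫ x in (0 : ℝ)..(z - a), ((x ^ s * ((z - a) - x) ^ (β - 1) : ℝ) : ℂ) =
        ∫ x in (0 : ℝ)..(z - a), (x : ℂ) ^ (((s + 1 : ℝ) : ℂ) - 1) *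
          (((z - a : ℝ) : ℂ) - x) ^ ((β : ℂ) - 1) := by
      refine intervalIntegral.integral_congr fun x hx => ?_
      rw [uIcc_of_le hL.le] at hx
      rw [Complex.ofReal_mul, Complex.ofReal_cpow hx.1,
        Complex.ofReal_cpow (sub_nonneg.2 hx.2)]
      push_cast
      congr 2
      ring
    rw [h4, h3, ← Complex.ofReal_add, Complex.Gamma_ofReal, Complex.Gamma_ofReal,
      Complex.Gamma_ofReal]
    push_cast
    rw [← Complex.ofReal_sub, Complex.ofReal_cpow hL.le]
    push_cast
    rw [show (s : ℂ) + 1 + β - 1 = s + β by ring]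
    ring

lemma cardinalBSpline_succ (p : ℕ) (t : ℝ) :
    cardinalBSpline (p + 1) t = (t / ((p : ℝ) + 1)) * cardinalBSpline p t
        + (((p : ℝ) + 2 - t) / ((p : ℝ) + 1)) * cardinalBSpline p (t - 1) := rfl

lemma sub_one_notMem_range_intCast {t : ℝ} (ht : t ∉ range ((↑) : ℤ → ℝ)) :
    t - 1 ∉ range ((↑) : ℤ → ℝ) := by
  rintro ⟨n, hn⟩
  exact ht ⟨n + 1, by push_cast; linarith⟩

lemma cardinalBSpline_eq_sum_truncPow (p : ℕ) {t : ℝ} (ht : t ∉ range ((↑) : ℤ → ℝ)) :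
    cardinalBSpline p t = (1 / (p.factorial : ℝ)) *
      ∑ j ∈ Finset.range (p + 2), (-1 : ℝ) ^ j * ((p + 1).choose j : ℝ) * truncPow p (t - j) := by
  induction p generalizing t with
  | zero =>
    have h0 : t ≠ 0 := fun h => ht ⟨0, by simp [h]⟩
    have h1 : t ≠ 1 := fun h => ht ⟨1, by simp [h]⟩
    simp only [cardinalBSpline, truncPow, Finset.sum_range_succ]
    rcases lt_or_gt_of_ne h0 with h | h
    · simp [h.not_gt, h.not_ge, show ¬ 1 < t by linarith]
    · rcases lt_or_gt_of_ne h1 with h' | h'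
      · simp [h, h.le, h', h'.not_gt]
      · simp [h, h.le, h', h'.not_gt]
  | succ p ih =>
    rw [cardinalBSpline_succ, ih ht, ih (sub_one_notMem_range_intCast ht)]
    have e1 : ∑ j ∈ Finset.range (p + 2), (-1 : ℝ) ^ j * ((p + 1).choose j : ℝ) *
        truncPow p (t - j) = ∑ j ∈ Finset.range (p + 2), (-1 : ℝ) ^ (j + 1) *
          ((p + 1).choose (j + 1) : ℝ) * truncPow p (t - 1 - j) + truncPow p t := by
      have := Finset.sum_range_succ' (fun j : ℕ => (-1 : ℝ) ^ j * ((p + 1).choose j : ℝ) *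
        truncPow p (t - j)) (p + 2)
      rw [Finset.sum_range_succ, Nat.choose_eq_zero_of_lt (by omega : p + 1 < p + 2)] at this
      simp only [Nat.cast_zero, mul_zero, zero_mul, add_zero, pow_zero, Nat.choose_zero_right,
        Nat.cast_one, one_mul, sub_zero] at this
      rw [this]
      congr 1
      refine Finset.sum_congr rfl fun j _ => ?_
      push_cast
      rw [show t - ((j : ℝ) + 1) = t - 1 - j by ring]
    have e2 : ∑ j ∈ Finset.range (p + 1 + 2), (-1 : ℝ) ^ j * ((p + 1 + 1).choose j : ℝ) *
        truncPow ((p + 1 : ℕ) : ℝ) (t - j) = ∑ j ∈ Finset.range (p + 2), (-1 : ℝ) ^ (j + 1) *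
          ((p + 2).choose (j + 1) : ℝ) * ((t - 1 - j) * truncPow p (t - 1 - j))
            + t * truncPow p t := by
      rw [Finset.sum_range_succ']
      push_cast
      simp only [truncPow_add_one, pow_zero, Nat.choose_zero_right, Nat.cast_one, one_mul, sub_zero]
      congr 1
      refine Finset.sum_congr rfl fun j _ => ?_
      rw [show t - ((j : ℝ) + 1) = t - 1 - j by ring]
    rw [e1, e2, Nat.factorial_succ]
    have hf : (p.factorial : ℝ) ≠ 0 := by positivity
    have hp : (p : ℝ) + 1 ≠ 0 := by positivity
    push_cast
    field_simp
    rw [mul_add, mul_comm t (∑ j ∈ _, _), Finset.sum_mul, Finset.mul_sum, add_right_comm,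
      ← Finset.sum_add_distrib]
    congr 1
    refine Finset.sum_congr rfl fun j _ => ?_
    have c1 : ((p + 2).choose (j + 1) : ℝ) = (p + 1).choose j + (p + 1).choose (j + 1) := by
      exact_mod_cast Nat.choose_succ_succ (p + 1) j
    have c2 : ((p : ℝ) + 2) * (p + 1).choose j = (p + 2).choose (j + 1) * (j + 1) := by
      have := Nat.add_one_mul_choose_eq (p + 1) j
      exact_mod_cast this
    rw [c1] at c2 ⊢
    rw [pow_succ]
    linear_combination ((-1 : ℝ) ^ j * truncPow p (t - 1 - j)) * c2

lemma cardinalBSpline_reflect (p : ℕ) {t : ℝ} (ht : t ∉ range ((↑) : ℤ → ℝ)) :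
    cardinalBSpline p ((p : ℝ) + 1 - t) = cardinalBSpline p t := by
  induction p generalizing t with
  | zero =>
    have h0 : t ≠ 0 := fun h => ht ⟨0, by simp [h]⟩
    have h1 : t ≠ 1 := fun h => ht ⟨1, by simp [h]⟩
    simp only [cardinalBSpline, Nat.cast_zero]
    congr 1
    apply propext
    constructor
    · rintro ⟨a, b⟩
      exact ⟨by linarith, lt_of_le_of_ne (by linarith) h1⟩
    · rintro ⟨a, b⟩
      have := lt_of_le_of_ne a h0.symm
      exact ⟨by linarith, by linarith⟩
  | succ p ih =>
    have h1 := ih (sub_one_notMem_range_intCast ht)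
    rw [cardinalBSpline_succ, cardinalBSpline_succ, ← h1, ← ih ht]
    push_cast
    rw [show (p : ℝ) + 1 + 1 - t - 1 = p + 1 - t by ring,
      show (p : ℝ) + 1 + 1 - t = p + 1 - (t - 1) by ring]
    ring

lemma ae_notMem_range_intCast : ∀ᵐ t : ℝ, t ∉ range ((↑) : ℤ → ℝ) :=
  measure_eq_zero_iff_ae_notMem.1 ((countable_range _).measure_zero _)

lemma lt_rlOrder (α : ℝ) : α < rlOrder α := by
  unfold rlOrder
  exact_mod_cast Nat.lt_floor_add_one α

lemma rlIntegralLeft_cardinalBSpline (p : ℕ) (α z : ℝ) :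
    rlIntegralLeft α (cardinalBSpline p) z =
      ∑ j ∈ Finset.range (p + 2), (Real.Gamma (rlOrder α - α) /
        Real.Gamma (p + 1 + (rlOrder α - α)) * ((-1 : ℝ) ^ j * ((p + 1).choose j : ℝ))) *
          truncPow (p + (rlOrder α - α)) (z - j) := by
  have hβ : 0 < (rlOrder α : ℝ) - α := sub_pos.2 (lt_rlOrder α)
  have hp : (-1 : ℝ) < p := by linarith [p.cast_nonneg (α := ℝ)]
  have hf : (p.factorial : ℝ) ≠ 0 := by positivity
  have key := fun j : ℕ => integral_Iic_mul_truncPow hβ hp (j : ℝ) z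
  have h1 : rlIntegralLeft α (cardinalBSpline p) z = ∫ y in Iic z,
      ∑ j ∈ Finset.range (p + 2), ((1 / (p.factorial : ℝ)) * ((-1 : ℝ) ^ j *
        ((p + 1).choose j : ℝ))) *
          ((z - y) ^ ((rlOrder α : ℝ) - α - 1) * truncPow p (y - j)) := by
    refine integral_congr_ae (ae_restrict_of_ae ?_)
    filter_upwards [ae_notMem_range_intCast] with y hy
    rw [cardinalBSpline_eq_sum_truncPow p hy, Finset.mul_sum, Finset.mul_sum]
    refine Finset.sum_congr rfl fun j _ => ?_
    ring
  rw [h1, integral_finsetSum _ fun j _ => ((key j).1.const_mul _)]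
  refine Finset.sum_congr rfl fun j _ => ?_
  rw [integral_const_mul, (key j).2, Real.Gamma_nat_eq_factorial]
  field_simp

lemma rlIntegralLeft_contDiffAt_and_fracDerivLeft {p : ℕ} {α x : ℝ} (hαp : α ≤ p)
    (h : α < p ∨ x ∉ range ((↑) : ℤ → ℝ)) :
    ContDiffAt ℝ (rlOrder α) (rlIntegralLeft α (cardinalBSpline p)) x ∧
    fracDerivLeft α (cardinalBSpline p) x = (1 / Real.Gamma (p - α + 1)) *
      ∑ j ∈ Finset.range (p + 2), (-1 : ℝ) ^ j * ((p + 1).choose j : ℝ) *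
        truncPow (p - α) (x - j) := by
  set m := rlOrder α with hm
  have hβ : 0 < (m : ℝ) - α := sub_pos.2 (lt_rlOrder α)
  have hle : (m : ℝ) ≤ p + (m - α) := by linarith
  have key : ∀ j : ℕ, ContDiffAt ℝ m (truncPow (p + (m - α))) (x - j) ∧
      iteratedDeriv m (truncPow (p + (m - α))) (x - j) =
        Real.Gamma (p + (m - α) + 1) / Real.Gamma (p - α + 1) * truncPow (p - α) (x - j) := by
    intro j
    have hx : α < p ∨ x - j ≠ 0 := h.imp_right fun h h0 =>
      h ⟨j, by push_cast; linarith⟩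
    obtain ⟨U, hU, hxU, hU0⟩ : ∃ U : Set ℝ, IsOpen U ∧ x - j ∈ U ∧
        (0 ∉ U ∨ (m : ℝ) < p + (m - α)) := by
      rcases hx with hx | hx
      · exact ⟨univ, isOpen_univ, mem_univ _, Or.inr (by linarith)⟩
      · exact ⟨{0}ᶜ, isOpen_compl_singleton, hx, Or.inl (by simp)⟩
    obtain ⟨h1, h2⟩ := truncPow_contDiffOn_and_iteratedDeriv m hU hle hU0
    refine ⟨h1.contDiffAt (hU.mem_nhds hxU), ?_⟩
    rw [h2 _ hxU, show (p : ℝ) + (m - α) + 1 - m = p - α + 1 by ring,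
      show (p : ℝ) + (m - α) - m = p - α by ring]
  have key' : ∀ j : ℕ, ContDiffAt ℝ m (fun y => truncPow (p + (m - α)) (y - j)) x :=
    fun j => (key j).1.comp x (contDiffAt_id.sub contDiffAt_const)
  have hf := funext (rlIntegralLeft_cardinalBSpline p α)
  rw [← hm] at hf
  constructor
  · rw [hf]
    exact ContDiffAt.sum fun j _ => contDiffAt_const.mul (key' j)
  · unfold fracDerivLeft
    rw [← hm, hf, iteratedDeriv_fun_sum fun j _ => contDiffAt_const.mul (key' j), Finset.mul_sum,
      Finset.mul_sum]
    refine Finset.sum_congr rfl fun j _ => ?_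
    rw [iteratedDeriv_const_mul_field, iteratedDeriv_comp_sub_const]
    simp only
    rw [(key j).2, show (p : ℝ) + (m - α) + 1 = p + 1 + (m - α) by ring]
    have g1 := (Real.Gamma_pos_of_pos hβ).ne'
    have g2 := (Real.Gamma_pos_of_pos (show 0 < (p : ℝ) + 1 + (m - α) by positivity)).ne'
    field_simp

lemma rlIntegralRight_cardinalBSpline (p : ℕ) (α z : ℝ) :
    rlIntegralRight α (cardinalBSpline p) z =
      rlIntegralLeft α (cardinalBSpline p) ((p : ℝ) + 1 - z) := by
  unfold rlIntegralRight rlIntegralLeft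
  have h1 : ∫ y in Ici z, (y - z) ^ ((rlOrder α : ℝ) - α - 1) * cardinalBSpline p y =
      ∫ y in Ici z, (y - z) ^ ((rlOrder α : ℝ) - α - 1) * cardinalBSpline p ((p : ℝ) + 1 - y) := by
    refine integral_congr_ae (ae_restrict_of_ae ?_)
    filter_upwards [ae_notMem_range_intCast] with y hy
    rw [cardinalBSpline_reflect p hy]
  rw [h1, ← integral_indicator measurableSet_Ici, ← integral_indicator measurableSet_Iic,
    ← integral_sub_left_eq_self _ volume ((p : ℝ) + 1)]
  congr 1
  ext y
  simp only [indicator, mem_Ici, mem_Iic]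
  congr 1
  · apply propext
    constructor <;> intro h <;> linarith
  · rw [sub_sub_cancel, show (p : ℝ) + 1 - y - z = p + 1 - z - y by ring]

lemma fracDerivRight_cardinalBSpline (p : ℕ) (α x : ℝ) :
    fracDerivRight α (cardinalBSpline p) x =
      fracDerivLeft α (cardinalBSpline p) ((p : ℝ) + 1 - x) := by
  unfold fracDerivRight fracDerivLeft
  rw [funext (rlIntegralRight_cardinalBSpline p α), iteratedDeriv_comp_const_sub]
  simp only [smul_eq_mul]
  rw [div_mul_eq_mul_div, ← mul_assoc, ← mul_pow]
  norm_num
  ring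

lemma rlIntegralRight_contDiffAt {p : ℕ} {α x : ℝ} (hαp : α ≤ p)
    (h : α < p ∨ x ∉ range ((↑) : ℤ → ℝ)) :
    ContDiffAt ℝ (rlOrder α) (rlIntegralRight α (cardinalBSpline p)) x := by
  rw [funext (rlIntegralRight_cardinalBSpline p α)]
  refine ContDiffAt.comp x (rlIntegralLeft_contDiffAt_and_fracDerivLeft hαp
    (h.imp_right ?_)).1 (contDiffAt_const.sub contDiffAt_id)
  rintro hx ⟨n, hn⟩
  exact hx ⟨p + 1 - n, by push_cast; linarith⟩

lemma integrable_truncPow_mul_exp {s b : ℝ} (hs : -1 < s) (hb : 0 < b) :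
    Integrable (fun x : ℝ => truncPow s x * Real.exp (-(b * x))) := by
  have h := integrableOn_rpow_mul_exp_neg_mul_rpow (p := 1) hs one_pos hb
  rw [← integrable_indicator_iff measurableSet_Ioi] at h
  refine h.congr (Eventually.of_forall fun x => ?_)
  simp only [indicator, truncPow, mem_Ioi, Real.rpow_one, neg_mul]
  split_ifs <;> simp

lemma norm_truncPow_mul_cexp (s x : ℝ) (w : ℂ) :
    ‖(truncPow s x : ℂ) * Complex.exp (-(w * x))‖ = truncPow s x * Real.exp (-(w.re * x)) := by
  rw [norm_mul, Complex.norm_real, Real.norm_of_nonneg (truncPow_nonneg s x), Complex.norm_exp]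
  simp

lemma aestronglyMeasurable_truncPow_mul_cexp (s : ℝ) (w : ℂ) :
    AEStronglyMeasurable (fun x : ℝ => (truncPow s x : ℂ) * Complex.exp (-(w * x))) :=
  ((Complex.measurable_ofReal.comp (measurable_truncPow s)).mul
    (by fun_prop)).aestronglyMeasurable

lemma integrable_truncPow_mul_cexp {s : ℝ} {w : ℂ} (hs : -1 < s) (hw : 0 < w.re) :
    Integrable (fun x : ℝ => (truncPow s x : ℂ) * Complex.exp (-(w * x))) := by
  refine (integrable_norm_iff (aestronglyMeasurable_truncPow_mul_cexp s w)).1 ?_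
  simp_rw [norm_truncPow_mul_cexp]
  exact integrable_truncPow_mul_exp hs hw

lemma differentiableAt_laplace_truncPow {s : ℝ} {w : ℂ} (hs : -1 < s) (hw : 0 < w.re) :
    DifferentiableAt ℂ
      (fun z : ℂ => ∫ x : ℝ, (truncPow s x : ℂ) * Complex.exp (-(z * x))) w := by
  have hs' : -1 < s + 1 := by linarith
  have hw2 : 0 < w.re / 2 := by linarith
  refine (hasDerivAt_integral_of_dominated_loc_of_deriv_le
    (F' := fun z x => -((truncPow (s + 1) x : ℂ) * Complex.exp (-(z * x))))
    (bound := fun x => truncPow (s + 1) x * Real.exp (-(w.re / 2 * x)))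
    (s := {z : ℂ | w.re / 2 < z.re}) ?_ ?_ ?_ ?_ ?_ ?_ ?_).2.differentiableAt
  · exact (Complex.isOpen_re_gt _).mem_nhds (show w.re / 2 < w.re by linarith)
  · exact Eventually.of_forall fun z => aestronglyMeasurable_truncPow_mul_cexp s z
  · exact integrable_truncPow_mul_cexp hs hw
  · exact (aestronglyMeasurable_truncPow_mul_cexp _ _).neg
  · refine Eventually.of_forall fun x z hz => ?_
    rw [norm_neg, norm_truncPow_mul_cexp]
    rcases lt_or_ge 0 x with hx | hx
    · refine mul_le_mul_of_nonneg_left (Real.exp_le_exp.2 ?_) (truncPow_nonneg _ _)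
      have : w.re / 2 < z.re := hz
      nlinarith
    · rw [truncPow_of_nonpos _ hx, zero_mul, zero_mul]
  · exact integrable_truncPow_mul_exp hs' hw2
  · refine Eventually.of_forall fun x z _ => ?_
    have h1 : HasDerivAt (fun z : ℂ => -(z * (x : ℂ))) (-(x : ℂ)) z := by
      simpa using ((hasDerivAt_id z).mul_const (x : ℂ)).fun_neg
    convert! h1.cexp.const_mul (truncPow s x : ℂ) using 1
    rw [truncPow_add_one]
    push_cast
    ring

lemma laplace_truncPow {s : ℝ} {w : ℂ} (hs : -1 < s) (hw : 0 < w.re) :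
    ∫ x : ℝ, (truncPow s x : ℂ) * Complex.exp (-(w * x)) =
      Real.Gamma (s + 1) * w ^ (-((s : ℂ) + 1)) := by
  let U : Set ℂ := {z : ℂ | 0 < z.re}
  have hU : IsOpen U := Complex.isOpen_re_gt 0
  have hslit : ∀ z ∈ U, z ∈ Complex.slitPlane := fun z hz => Or.inl hz
  have hF : AnalyticOnNhd ℂ
      (fun z : ℂ => ∫ x : ℝ, (truncPow s x : ℂ) * Complex.exp (-(z * x))) U :=
    DifferentiableOn.analyticOnNhd
      (fun z hz => (differentiableAt_laplace_truncPow hs hz).differentiableWithinAt) hU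
  have hG : AnalyticOnNhd ℂ
      (fun z : ℂ => (Real.Gamma (s + 1) : ℂ) * z ^ (-((s : ℂ) + 1))) U :=
    DifferentiableOn.analyticOnNhd (fun z hz =>
      ((differentiableAt_id.cpow_const (hslit z hz)).const_mul _).differentiableWithinAt) hU
  have hreal : ∀ r : ℝ, 0 < r → ∫ x : ℝ, (truncPow s x : ℂ) * Complex.exp (-((r : ℂ) * x)) =
      Real.Gamma (s + 1) * (r : ℂ) ^ (-((s : ℂ) + 1)) := by
    intro r hr
    have h1 : ∫ x : ℝ, truncPow s x * Real.exp (-(r * x)) =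
        (1 / r) ^ (s + 1) * Real.Gamma (s + 1) := by
      rw [← Real.integral_rpow_mul_exp_neg_mul_Ioi (by linarith) hr,
        ← integral_indicator measurableSet_Ioi]
      congr 1
      ext x
      simp only [indicator, truncPow, mem_Ioi, add_sub_cancel_right]
      split_ifs <;> simp
    have h2 : ∫ x : ℝ, (truncPow s x : ℂ) * Complex.exp (-((r : ℂ) * x)) =
        ((∫ x : ℝ, truncPow s x * Real.exp (-(r * x)) : ℝ) : ℂ) := by
      rw [← integral_complex_ofReal]
      congr 1
      ext x
      push_cast
      rfl
    rw [h2, h1, one_div, Real.inv_rpow hr.le, ← Real.rpow_neg hr.le]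
    push_cast
    rw [Complex.ofReal_cpow hr.le]
    push_cast
    ring
  have h1U : (1 : ℂ) ∈ U := by simp [U]
  refine hF.eqOn_of_preconnected_of_frequently_eq hG
    (convex_halfSpace_re_gt 0).isPreconnected h1U ?_ hw
  have ht : Tendsto (fun r : ℝ => (r : ℂ)) (𝓝[≠] 1) (𝓝[≠] (1 : ℂ)) := by
    refine tendsto_nhdsWithin_iff.2 ⟨?_, ?_⟩
    · have := (Complex.continuous_ofReal.tendsto 1).mono_left
        (nhdsWithin_le_nhds (s := {(1 : ℝ)}ᶜ))
      simpa using this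
    · filter_upwards [self_mem_nhdsWithin] with r hr
      simpa using hr
  refine ht.frequently (Eventually.frequently ?_)
  filter_upwards [nhdsWithin_le_nhds (Ioi_mem_nhds one_pos)] with r hr using hreal r hr

/-- The linear combination of shifted truncated powers that represents the left
Riemann–Liouville derivative of order `α` of the cardinal B-spline of degree `p`. -/
noncomputable def fracBSpline (p : ℕ) (α x : ℝ) : ℝ :=
  (1 / Real.Gamma (p - α + 1)) *
    ∑ j ∈ Finset.range (p + 2), (-1 : ℝ) ^ j * ((p + 1).choose j : ℝ) * truncPow (p - α) (x - j)

/-- The Laplace transform of `fracBSpline p α`. -/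
noncomputable def fracBSplineLaplace (p : ℕ) (α : ℝ) (w : ℂ) : ℂ :=
  ((1 - Complex.exp (-w)) / w) ^ (p + 1) * w ^ (α : ℂ)

lemma laplace_fracBSpline {p : ℕ} {α : ℝ} {w : ℂ} (hα : α < p) (hw : 0 < w.re) :
    Integrable (fun x : ℝ => (fracBSpline p α x : ℂ) * Complex.exp (-(w * x))) ∧
    ∫ x : ℝ, (fracBSpline p α x : ℂ) * Complex.exp (-(w * x)) = fracBSplineLaplace p α w := by
  have hs : -1 < (p : ℝ) - α := by linarith
  have hΓ : (Real.Gamma (p - α + 1) : ℂ) ≠ 0 :=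
    Complex.ofReal_ne_zero.2 (Real.Gamma_pos_of_pos (by linarith)).ne'
  have hw0 : w ≠ 0 := by
    rintro rfl
    simp at hw
  have hshift : ∀ (j : ℕ) (x : ℝ), (truncPow (p - α) (x - j) : ℂ) * Complex.exp (-(w * x)) =
      Complex.exp (-w) ^ j * ((truncPow (p - α) (x - j) : ℂ) *
        Complex.exp (-(w * ((x - j : ℝ) : ℂ)))) := by
    intro j x
    rw [← Complex.exp_nat_mul, mul_left_comm, ← Complex.exp_add]
    congr 2
    push_cast
    ring
  have hint : ∀ j : ℕ, Integrable
      (fun x : ℝ => (truncPow (p - α) (x - j) : ℂ) * Complex.exp (-(w * x))) := by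
    intro j
    simp_rw [hshift j]
    exact ((integrable_truncPow_mul_cexp hs hw).comp_sub_right (j : ℝ)).const_mul _
  have hval : ∀ j : ℕ, ∫ x : ℝ, (truncPow (p - α) (x - j) : ℂ) * Complex.exp (-(w * x)) =
      Complex.exp (-w) ^ j * (Real.Gamma (p - α + 1) * w ^ (-(((p - α : ℝ) : ℂ) + 1))) := by
    intro j
    simp_rw [hshift j]
    rw [integral_const_mul, integral_sub_right_eq_self
      (fun x : ℝ => (truncPow (p - α) x : ℂ) * Complex.exp (-(w * x))) (j : ℝ),
      laplace_truncPow hs hw]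
  have hexp : ∀ x : ℝ, (fracBSpline p α x : ℂ) * Complex.exp (-(w * x)) =
      ∑ j ∈ Finset.range (p + 2), ((1 / (Real.Gamma (p - α + 1) : ℂ)) *
        ((-1 : ℂ) ^ j * ((p + 1).choose j : ℂ))) *
          ((truncPow (p - α) (x - j) : ℂ) * Complex.exp (-(w * x))) := by
    intro x
    unfold fracBSpline
    push_cast
    rw [mul_assoc, Finset.sum_mul, Finset.mul_sum]
    refine Finset.sum_congr rfl fun j _ => ?_
    ring
  simp_rw [hexp]
  refine ⟨integrable_finsetSum _ fun j _ => (hint j).const_mul _, ?_⟩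
  rw [integral_finsetSum _ fun j _ => (hint j).const_mul _]
  simp_rw [integral_const_mul, hval]
  have hbin : (1 - Complex.exp (-w)) ^ (p + 1) = ∑ j ∈ Finset.range (p + 2),
      (-1 : ℂ) ^ j * ((p + 1).choose j : ℂ) * Complex.exp (-w) ^ j := by
    rw [sub_eq_neg_add, add_pow]
    refine Finset.sum_congr rfl fun j _ => ?_
    rw [neg_pow, one_pow]
    ring
  have hpow : w ^ (-(((p - α : ℝ) : ℂ) + 1)) = w ^ (α : ℂ) / w ^ (p + 1) := by
    rw [← Complex.cpow_natCast, ← Complex.cpow_sub _ _ hw0]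
    congr 1
    push_cast
    ring
  unfold fracBSplineLaplace
  rw [div_pow, hbin, Finset.sum_div, Finset.sum_mul]
  refine Finset.sum_congr rfl fun j _ => ?_
  rw [hpow]
  field_simp

lemma norm_one_sub_cexp_neg_div_le {w : ℂ} (hw : 0 ≤ w.re) :
    ‖(1 - Complex.exp (-w)) / w‖ ≤ 4 / (1 + ‖w‖) := by
  have h2 : ‖1 - Complex.exp (-w)‖ ≤ 2 := by
    refine (norm_sub_le _ _).trans ?_
    rw [norm_one, Complex.norm_exp]
    have : Real.exp (-w).re ≤ 1 := Real.exp_le_one_iff.2 (by simpa using hw)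
    linarith
  rcases eq_or_ne w 0 with rfl | h0
  · simp
  have hpos : 0 < ‖w‖ := norm_pos_iff.2 h0
  rw [norm_div, div_le_div_iff₀ hpos (by positivity)]
  rcases le_or_gt ‖w‖ 1 with h | h
  · have h1 : ‖1 - Complex.exp (-w)‖ ≤ 2 * ‖w‖ := by
      rw [norm_sub_rev]
      simpa using Complex.norm_exp_sub_one_le (x := -w) (by simpa using h)
    nlinarith
  · nlinarith

lemma norm_fracBSplineLaplace_le (p : ℕ) {α ε : ℝ} (hα : 0 ≤ α) (hε : 0 ≤ ε) (hε1 : ε ≤ 1)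
    (t : ℝ) : ‖fracBSplineLaplace p α (ε + t * Complex.I)‖ ≤
      4 ^ (p + 1) * (1 + ‖t‖) ^ (-(p + 1 - α)) := by
  set w : ℂ := ε + t * Complex.I with hw
  have hre : w.re = ε := by simp [hw]
  have him : w.im = t := by simp [hw]
  have h1 : |t| ≤ ‖w‖ := him ▸ Complex.abs_im_le_norm w
  have h2 : ‖w‖ ≤ 1 + |t| := by
    have := Complex.norm_le_abs_re_add_abs_im w
    rw [hre, him, abs_of_nonneg hε] at this
    linarith
  have hb := norm_one_sub_cexp_neg_div_le (w := w) (by rw [hre]; exact hε)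
  have hpos : 0 < 1 + |t| := by positivity
  unfold fracBSplineLaplace
  rw [norm_mul, norm_pow, Complex.norm_cpow_real, Real.norm_eq_abs]
  calc _ ≤ (4 / (1 + |t|)) ^ (p + 1) * (1 + |t|) ^ α := by
        gcongr
        refine hb.trans ?_
        gcongr
    _ = _ := by
        rw [show -((p : ℝ) + 1 - α) = α - ((p + 1 : ℕ) : ℝ) by push_cast; ring,
          Real.rpow_sub hpos, Real.rpow_natCast, div_pow]
        field_simp

lemma integrable_one_add_norm_rpow {r : ℝ} (hr : 1 < r) :
    Integrable (fun t : ℝ => (1 + ‖t‖) ^ (-r)) :=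
  integrable_one_add_norm (by simpa using hr)

lemma measurable_fracBSplineLaplace_line (p : ℕ) (α ε : ℝ) :
    Measurable fun t : ℝ => fracBSplineLaplace p α (ε + t * Complex.I) := by
  unfold fracBSplineLaplace
  fun_prop

lemma integrable_fracBSplineLaplace_line {p : ℕ} {α ε : ℝ} (hα : 0 ≤ α) (hαp : α < p)
    (hε : 0 ≤ ε) (hε1 : ε ≤ 1) :
    Integrable fun t : ℝ => fracBSplineLaplace p α (ε + t * Complex.I) :=
  ((integrable_one_add_norm_rpow (r := p + 1 - α) (by linarith)).const_mul _).mono'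
    (measurable_fracBSplineLaplace_line p α ε).aestronglyMeasurable
    (Eventually.of_forall fun t => norm_fracBSplineLaplace_le p hα hε hε1 t)

lemma continuous_fracBSpline {p : ℕ} {α : ℝ} (hα : α < p) : Continuous (fracBSpline p α) := by
  unfold fracBSpline
  refine continuous_const.mul (continuous_finsetSum _ fun j _ => continuous_const.mul ?_)
  exact (continuous_truncPow (sub_pos.2 hα)).comp (continuous_id.sub continuous_const)

lemma exp_mul_fracBSpline_eq_integral {p : ℕ} {α ε : ℝ} (hα : 0 ≤ α) (hαp : α < p)
    (hε : 0 < ε) (hε1 : ε ≤ 1) (x : ℝ) :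
    (fracBSpline p α x : ℂ) * Complex.exp (-(ε * x)) = (1 / (2 * Real.pi)) *
      ∫ t : ℝ, Complex.exp (x * t * Complex.I) * fracBSplineLaplace p α (ε + t * Complex.I) := by
  have h2π : 2 * Real.pi ≠ 0 := by positivity
  set h : ℝ → ℂ := fun x => (fracBSpline p α x : ℂ) * Complex.exp (-(ε * x)) with hh
  have hint : Integrable h := (laplace_fracBSpline (w := (ε : ℂ)) hαp (by simpa using hε)).1
  have hcont : Continuous h := by
    refine (Complex.continuous_ofReal.comp (continuous_fracBSpline hαp)).mul ?_
    fun_prop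
  have hF : FourierTransform.fourier h = fun ξ : ℝ =>
      fracBSplineLaplace p α (ε + ((2 * Real.pi * ξ : ℝ) : ℂ) * Complex.I) := by
    ext ξ
    rw [Real.fourier_real_eq_integral_exp_smul,
      ← (laplace_fracBSpline (w := ε + ((2 * Real.pi * ξ : ℝ) : ℂ) * Complex.I) hαp
        (by simpa using hε)).2]
    congr 1
    ext v
    rw [smul_eq_mul, hh, mul_left_comm, ← Complex.exp_add]
    congr 2
    push_cast
    ring
  have hFint : Integrable (FourierTransform.fourier h) := by
    rw [hF]
    exact (integrable_fracBSplineLaplace_line hα hαp hε.le hε1).comp_mul_left' h2π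
  have hinv := hint.fourierInv_fourier_eq hFint (hcont.continuousAt (x := x))
  rw [Real.fourierInv_eq', hF] at hinv
  change _ = h x at hinv
  change h x = _
  rw [← hinv]
  have := Measure.integral_comp_mul_left (fun t : ℝ => Complex.exp (x * t * Complex.I) *
    fracBSplineLaplace p α (ε + t * Complex.I)) (2 * Real.pi)
  rw [abs_of_pos (by positivity), Complex.real_smul] at this
  push_cast at this
  rw [one_div, ← this]
  congr 1
  ext v
  rw [smul_eq_mul]
  simp only [RCLike.inner_apply, conj_trivial]
  push_cast
  congr 2
  ring

lemma fracBSpline_eq_integral {p : ℕ} {α : ℝ} (hα : 0 ≤ α) (hαp : α < p) (x : ℝ) :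
    (fracBSpline p α x : ℂ) = (1 / (2 * Real.pi)) *
      ∫ t : ℝ, Complex.exp (x * t * Complex.I) * fracBSplineLaplace p α (t * Complex.I) := by
  have hIoc : Ioc (0 : ℝ) 1 ∈ 𝓝[>] (0 : ℝ) := Ioc_mem_nhdsGT one_pos
  have h1 : Tendsto (fun ε : ℝ => (fracBSpline p α x : ℂ) * Complex.exp (-(ε * x))) (𝓝[>] 0)
      (𝓝 (fracBSpline p α x)) := by
    have : Continuous fun ε : ℝ => (fracBSpline p α x : ℂ) * Complex.exp (-(ε * x)) := by
      fun_prop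
    simpa using (this.tendsto 0).mono_left nhdsWithin_le_nhds
  have h2 : Tendsto (fun ε : ℝ => ∫ t : ℝ, Complex.exp (x * t * Complex.I) *
      fracBSplineLaplace p α (ε + t * Complex.I)) (𝓝[>] 0) (𝓝 (∫ t : ℝ,
        Complex.exp (x * t * Complex.I) * fracBSplineLaplace p α (t * Complex.I))) := by
    refine tendsto_integral_filter_of_dominated_convergence
      (fun t => 4 ^ (p + 1) * (1 + ‖t‖) ^ (-(p + 1 - α))) ?_ ?_ ?_ ?_
    · refine Eventually.of_forall fun ε => ?_
      exact (Measurable.mul (by fun_prop)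
        (measurable_fracBSplineLaplace_line p α ε)).aestronglyMeasurable
    · filter_upwards [hIoc] with ε hε
      refine Eventually.of_forall fun t => ?_
      have : ‖Complex.exp (x * t * Complex.I)‖ = 1 := by
        exact_mod_cast Complex.norm_exp_ofReal_mul_I (x * t)
      rw [norm_mul, this, one_mul]
      exact norm_fracBSplineLaplace_le p hα hε.1.le hε.2 t
    · exact (integrable_one_add_norm_rpow (by linarith)).const_mul _
    · have hne : ∀ᵐ t : ℝ, t ≠ 0 := measure_eq_zero_iff_ae_notMem.1 (measure_singleton 0)
      filter_upwards [hne] with t ht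
      have hw0 : (t : ℂ) * Complex.I ≠ 0 :=
        mul_ne_zero (Complex.ofReal_ne_zero.2 ht) Complex.I_ne_zero
      have hK : ContinuousAt (fracBSplineLaplace p α) (t * Complex.I) := by
        unfold fracBSplineLaplace
        refine ContinuousAt.mul (ContinuousAt.pow (ContinuousAt.div ?_ continuousAt_id hw0) _) ?_
        · fun_prop
        · exact continuousAt_id.cpow continuousAt_const (Or.inr (by simpa using ht))
      refine Tendsto.const_mul _ (hK.tendsto.comp ?_)
      have : Continuous fun ε : ℝ => (ε : ℂ) + t * Complex.I := by fun_prop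
      simpa using (this.tendsto 0).mono_left nhdsWithin_le_nhds
  refine tendsto_nhds_unique h1 ((h2.const_mul _).congr' ?_)
  filter_upwards [hIoc] with ε hε
  rw [exp_mul_fracBSpline_eq_integral hα hαp hε.1 hε.2]

/-- The function on the real line whose `2π`-periodization is the symbol. -/
noncomputable def symbolDensity (p : ℕ) (α t : ℝ) : ℝ :=
  |t| ^ α * Real.sinc (t / 2) ^ (p + 1)

lemma symbolTerm_eq_symbolDensity (p : ℕ) (α θ : ℝ) (l : ℤ) :
    symbolTerm p α θ l = symbolDensity p α (θ + 2 * l * Real.pi) := by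
  unfold symbolTerm symbolDensity
  rw [show (θ + 2 * l * Real.pi) / 2 = θ / 2 + l * Real.pi by ring]

lemma cpow_mul_I_add_cpow_neg_mul_I {t : ℝ} (ht : t ≠ 0) (α : ℝ) :
    ((t : ℂ) * Complex.I) ^ (α : ℂ) + (((-t : ℝ) : ℂ) * Complex.I) ^ (α : ℂ) =
      ((2 * Real.cos (Real.pi * α / 2) * |t| ^ α : ℝ) : ℂ) := by
  wlog h : 0 < t generalizing t with H
  · have h' : 0 < -t := by
      rcases lt_or_gt_of_ne ht with h1 | h1
      · linarith
      · exact absurd h1 h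
    have := H (neg_ne_zero.2 ht) h'
    rw [neg_neg, abs_neg] at this
    rw [← this, add_comm]
  have h1 : Complex.log ((t : ℂ) * Complex.I) =
      (Real.log t : ℂ) + Real.pi / 2 * Complex.I := by
    rw [Complex.log_ofReal_mul h Complex.I_ne_zero, Complex.log_I]
  have h2 : Complex.log (((-t : ℝ) : ℂ) * Complex.I) =
      (Real.log t : ℂ) + -(Real.pi / 2) * Complex.I := by
    rw [show ((-t : ℝ) : ℂ) * Complex.I = (t : ℂ) * (-Complex.I) by push_cast; ring,
      Complex.log_ofReal_mul h (neg_ne_zero.2 Complex.I_ne_zero), Complex.log_neg_I]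
  have hI := Complex.I_ne_zero
  have ht' : (t : ℂ) ≠ 0 := Complex.ofReal_ne_zero.2 ht
  have ht'' : ((-t : ℝ) : ℂ) ≠ 0 := Complex.ofReal_ne_zero.2 (neg_ne_zero.2 ht)
  rw [Complex.cpow_def_of_ne_zero (mul_ne_zero ht' hI),
    Complex.cpow_def_of_ne_zero (mul_ne_zero ht'' hI), h1, h2, abs_of_pos h,
    Real.rpow_def_of_pos h]
  push_cast
  rw [Complex.cos, add_mul, add_mul, Complex.exp_add, Complex.exp_add]
  rw [show (Real.pi : ℂ) / 2 * Complex.I * α = Real.pi * α / 2 * Complex.I by ring,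
    show -((Real.pi : ℂ) / 2) * Complex.I * α = -(Real.pi * α / 2) * Complex.I by ring]
  ring

lemma fracBSplineLaplace_mul_I (p : ℕ) (α : ℝ) {t : ℝ} (ht : t ≠ 0) :
    fracBSplineLaplace p α (t * Complex.I) =
      Complex.exp (-(((p : ℂ) + 1) / 2 * t * Complex.I)) *
        ((Real.sinc (t / 2) ^ (p + 1) : ℝ) : ℂ) * ((t : ℂ) * Complex.I) ^ (α : ℂ) := by
  have ht' : (t : ℂ) ≠ 0 := Complex.ofReal_ne_zero.2 ht
  have h1 : (1 - Complex.exp (-((t : ℂ) * Complex.I))) / (t * Complex.I) =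
      Complex.exp (-((t : ℂ) / 2 * Complex.I)) * (Real.sinc (t / 2) : ℂ) := by
    rw [Real.sinc_of_ne_zero (div_ne_zero ht two_ne_zero)]
    push_cast
    rw [Complex.sin]
    have e1 : Complex.exp (-((t : ℂ) * Complex.I)) =
      Complex.exp (-((t : ℂ) / 2 * Complex.I)) * Complex.exp (-((t : ℂ) / 2 * Complex.I)) := by
      rw [← Complex.exp_add]
      ring_nf
    have e2 : Complex.exp (-((t : ℂ) / 2 * Complex.I)) * Complex.exp ((t : ℂ) / 2 * Complex.I)
        = 1 := by
      rw [← Complex.exp_add]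
      simp
    rw [e1, neg_mul]
    generalize Complex.exp (-((t : ℂ) / 2 * Complex.I)) = E at e2 ⊢
    generalize Complex.exp ((t : ℂ) / 2 * Complex.I) = F at e2 ⊢
    field_simp
    rw [Complex.I_sq]
    linear_combination -e2
  unfold fracBSplineLaplace
  rw [h1, mul_pow, ← Complex.exp_nat_mul]
  push_cast
  congr 3
  ring

lemma norm_symbolDensity_le (p : ℕ) {α : ℝ} (hα : 0 ≤ α) (t : ℝ) :
    ‖symbolDensity p α t‖ ≤ 4 ^ (p + 1) * (1 + ‖t‖) ^ (-(p + 1 - α)) := by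
  rcases eq_or_ne t 0 with rfl | ht
  · have h1 : |(0 : ℝ)| ^ α ≤ 1 := Real.rpow_le_one (by simp) (by simp) hα
    have h0 : 0 ≤ |(0 : ℝ)| ^ α := by positivity
    have h4 : (1 : ℝ) ≤ 4 ^ (p + 1) := one_le_pow₀ (by norm_num)
    simp only [symbolDensity, zero_div, Real.sinc_zero, one_pow, mul_one, norm_zero, add_zero,
      Real.one_rpow]
    rw [Real.norm_of_nonneg h0]
    exact h1.trans h4
  · have h := norm_fracBSplineLaplace_le p hα le_rfl zero_le_one t
    rw [Complex.ofReal_zero, zero_add, fracBSplineLaplace_mul_I p α ht, norm_mul, norm_mul,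
      Complex.norm_cpow_real, Complex.norm_real] at h
    have he : ‖Complex.exp (-(((p : ℂ) + 1) / 2 * t * Complex.I))‖ = 1 := by
      have := Complex.norm_exp_ofReal_mul_I (-(((p : ℝ) + 1) / 2 * t))
      push_cast at this
      rwa [neg_mul] at this
    rw [he, one_mul, norm_mul, Complex.norm_I, mul_one, Complex.norm_real, mul_comm] at h
    unfold symbolDensity
    rw [norm_mul, Real.norm_of_nonneg (by positivity : 0 ≤ |t| ^ α), ← Real.norm_eq_abs]
    exact h

lemma continuous_symbolDensity (p : ℕ) {α : ℝ} (hα : 0 ≤ α) : Continuous (symbolDensity p α) := by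
  unfold symbolDensity
  exact (continuous_abs.rpow_const fun _ => Or.inr hα).mul
    ((Real.continuous_sinc.comp (continuous_id.div_const 2)).pow _)

lemma norm_cexp_mul_mul_I (y t : ℝ) : ‖Complex.exp (y * t * Complex.I)‖ = 1 := by
  exact_mod_cast Complex.norm_exp_ofReal_mul_I (y * t)

lemma integrable_cexp_mul_symbolDensity {p : ℕ} {α : ℝ} (hα : 0 ≤ α) (hαp : α < p) (y : ℝ) :
    Integrable fun t : ℝ => Complex.exp (y * t * Complex.I) * (symbolDensity p α t : ℂ) := by
  refine ((integrable_one_add_norm_rpow (r := p + 1 - α) (by linarith)).const_mul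
    (4 ^ (p + 1))).mono' ?_ (Eventually.of_forall fun t => ?_)
  · refine Continuous.aestronglyMeasurable (Continuous.mul (by fun_prop) ?_)
    exact Complex.continuous_ofReal.comp (continuous_symbolDensity p hα)
  · rw [norm_mul, norm_cexp_mul_mul_I, one_mul, Complex.norm_real]
    exact norm_symbolDensity_le p hα t

lemma fracBSpline_add_reflect_eq_integral {p : ℕ} {α : ℝ} (hα : 0 ≤ α) (hαp : α < p) (y : ℝ) :
    ((fracBSpline p α (((p : ℝ) + 1) / 2 + y) + fracBSpline p α (((p : ℝ) + 1) / 2 - y) : ℝ) : ℂ) =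
      ((2 * Real.cos (Real.pi * α / 2) : ℝ) : ℂ) * ((1 / (2 * Real.pi)) *
        ∫ t : ℝ, Complex.exp (y * t * Complex.I) * (symbolDensity p α t : ℂ)) := by
  have hne : ∀ᵐ t : ℝ, t ≠ 0 := measure_eq_zero_iff_ae_notMem.1 (measure_singleton 0)
  have hint : ∀ x : ℝ, Integrable fun t : ℝ =>
      Complex.exp (x * t * Complex.I) * fracBSplineLaplace p α (t * Complex.I) := by
    intro x
    have h := integrable_fracBSplineLaplace_line hα hαp le_rfl zero_le_one
    simp only [Complex.ofReal_zero, zero_add] at h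
    refine (integrable_norm_iff ?_).1 (h.norm.congr (Eventually.of_forall fun t => ?_))
    · exact AEStronglyMeasurable.mul (Continuous.aestronglyMeasurable (by fun_prop))
        h.aestronglyMeasurable
    · simp only
      rw [norm_mul, norm_cexp_mul_mul_I, one_mul]
  set A : ℝ → ℂ := fun t => Complex.exp (((((p : ℝ) + 1) / 2 + y : ℝ) : ℂ) * t * Complex.I) *
    fracBSplineLaplace p α (t * Complex.I) with hA
  set B : ℝ → ℂ := fun t => Complex.exp (((((p : ℝ) + 1) / 2 - y : ℝ) : ℂ) * t * Complex.I) *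
    fracBSplineLaplace p α (t * Complex.I) with hB
  have hAi : Integrable A := hint _
  have hBi : Integrable fun t => B (-t) := (hint _).comp_neg
  have hBneg : ∫ t, B t = ∫ t, B (-t) := (integral_neg_eq_self B volume).symm
  rw [Complex.ofReal_add, fracBSpline_eq_integral hα hαp, fracBSpline_eq_integral hα hαp,
    hBneg, ← mul_add, ← integral_add hAi hBi, mul_left_comm,
    ← integral_const_mul ((2 * Real.cos (Real.pi * α / 2) : ℝ) : ℂ)]
  congr 1
  refine integral_congr_ae ?_
  filter_upwards [hne] with t ht
  have hsinc : Real.sinc (-t / 2) = Real.sinc (t / 2) := by rw [neg_div, Real.sinc_neg]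
  have hc := cpow_mul_I_add_cpow_neg_mul_I ht α
  simp only [hA, hB]
  rw [fracBSplineLaplace_mul_I p α ht, fracBSplineLaplace_mul_I p α (neg_ne_zero.2 ht), hsinc]
  rw [← mul_assoc, ← mul_assoc, ← mul_assoc, ← mul_assoc, ← Complex.exp_add, ← Complex.exp_add]
  have e1 : (((((p : ℝ) + 1) / 2 + y : ℝ) : ℂ) * t * Complex.I +
      -(((p : ℂ) + 1) / 2 * t * Complex.I)) = y * t * Complex.I := by
    push_cast
    ring
  have e2 : (((((p : ℝ) + 1) / 2 - y : ℝ) : ℂ) * ((-t : ℝ) : ℂ) * Complex.I +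
      -(((p : ℂ) + 1) / 2 * ((-t : ℝ) : ℂ) * Complex.I)) = y * t * Complex.I := by
    push_cast
    ring
  rw [e1, e2, ← mul_add, hc]
  unfold symbolDensity
  push_cast
  ring

lemma summable_one_add_abs_int_rpow {r : ℝ} (hr : 1 < r) :
    Summable fun l : ℤ => (1 + |(l : ℝ)|) ^ (-r) := by
  have h : Summable fun n : ℕ => (1 + |((n : ℤ) : ℝ)|) ^ (-r) := by
    have h1 : Summable fun n : ℕ => (n : ℝ) ^ (-r) := Real.summable_nat_rpow.2 (by linarith)
    refine ((summable_nat_add_iff 1).2 h1).congr fun n => ?_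
    push_cast
    rw [abs_of_nonneg n.cast_nonneg, add_comm]
  refine summable_int_iff_summable_nat_and_neg.2 ⟨h, ?_⟩
  simpa using h

lemma norm_symbolTerm_le {p : ℕ} {α θ : ℝ} (hα : 0 ≤ α) (hαp : α < p)
    (hθ : θ ∈ Icc (-Real.pi) Real.pi) (l : ℤ) :
    ‖symbolTerm p α θ l‖ ≤ 4 ^ (p + 1) * (1 + |(l : ℝ)|) ^ (-(p + 1 - α)) := by
  rw [symbolTerm_eq_symbolDensity]
  refine (norm_symbolDensity_le p hα _).trans ?_
  have hl : |(l : ℝ)| ≤ ‖θ + 2 * l * Real.pi‖ := by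
    rcases eq_or_ne l 0 with rfl | h0
    · simp
    have h1 : (1 : ℝ) ≤ |(l : ℝ)| := by exact_mod_cast Int.one_le_abs h0
    have h2 : |2 * l * Real.pi| = 2 * |(l : ℝ)| * Real.pi := by
      rw [abs_mul, abs_mul, abs_of_pos Real.pi_pos, abs_two]
    have h3 : |θ| ≤ Real.pi := abs_le.2 hθ
    have h4 : |2 * l * Real.pi| ≤ |θ + 2 * l * Real.pi| + |θ| := by
      have := abs_sub (θ + 2 * l * Real.pi) θ
      rwa [add_sub_cancel_left] at this
    rw [Real.norm_eq_abs]
    have := Real.pi_gt_three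
    nlinarith
  refine mul_le_mul_of_nonneg_left ?_ (by positivity)
  exact Real.rpow_le_rpow_of_nonpos (by positivity) (by linarith) (by linarith)

lemma summable_symbolTerm_bound {p : ℕ} {α : ℝ} (hαp : α < p) :
    Summable fun l : ℤ => (4 : ℝ) ^ (p + 1) * (1 + |(l : ℝ)|) ^ (-(p + 1 - α)) :=
  (summable_one_add_abs_int_rpow (by linarith)).mul_left _

lemma hasSum_symbolTerm {p : ℕ} {α θ : ℝ} (hα : 0 ≤ α) (hαp : α < p)
    (hθ : θ ∈ Icc (-Real.pi) Real.pi) : HasSum (symbolTerm p α θ) (fSymbol p α θ) := by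
  have hs : Summable (symbolTerm p α θ) :=
    Summable.of_norm_bounded (summable_symbolTerm_bound hαp) (norm_symbolTerm_le hα hαp hθ)
  unfold fSymbol
  rw [tsum_eq_of_summable_unconditional hs]
  exact hs.hasSum

lemma hasSum_symmetricIcc_symbolTerm {p : ℕ} {α θ : ℝ} (hα : 0 ≤ α) (hαp : α < p)
    (hθ : θ ∈ Icc (-Real.pi) Real.pi) :
    HasSum (symbolTerm p α θ) (fSymbol p α θ) (SummationFilter.symmetricIcc ℤ) :=
  Tendsto.mono_left (hasSum_symbolTerm hα hαp hθ)
    (SummationFilter.symmetricIcc ℤ).le_atTop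

lemma continuous_symbolTerm (p : ℕ) {α : ℝ} (hα : 0 ≤ α) (l : ℤ) :
    Continuous fun θ => symbolTerm p α θ l := by
  simp_rw [symbolTerm_eq_symbolDensity]
  exact (continuous_symbolDensity p hα).comp (continuous_id.add continuous_const)

lemma intervalIntegrable_fSymbol {p : ℕ} {α : ℝ} (hα : 0 ≤ α) (hαp : α < p) :
    IntervalIntegrable (fSymbol p α) volume (-Real.pi) Real.pi := by
  have hπ : -Real.pi ≤ Real.pi := by linarith [Real.pi_pos]
  have hc : ContinuousOn (fun θ => ∑' l, symbolTerm p α θ l) (Icc (-Real.pi) Real.pi) :=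
    continuousOn_tsum (fun l => (continuous_symbolTerm p hα l).continuousOn)
      (summable_symbolTerm_bound hαp) fun l θ hθ => norm_symbolTerm_le hα hαp hθ l
  refine ContinuousOn.intervalIntegrable ?_
  rw [uIcc_of_le hπ]
  exact hc.congr fun θ hθ => (hasSum_symbolTerm hα hαp hθ).tsum_eq.symm

lemma integral_symbolTerm_mul_cexp (p : ℕ) (α : ℝ) (k l : ℤ) :
    (1 / (2 * (Real.pi : ℂ))) * ∫ θ in (-Real.pi)..Real.pi,
        (symbolTerm p α θ l : ℂ) * Complex.exp (-(Complex.I * k * θ)) =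
      ∫ u in (-(1 / 2) + l : ℝ)..(-(1 / 2) + l + 1), (fun t : ℝ =>
        Complex.exp (((-k : ℝ) : ℂ) * t * Complex.I) * (symbolDensity p α t : ℂ))
          (2 * Real.pi * u) := by
  have h2π : 2 * Real.pi ≠ 0 := by positivity
  rw [intervalIntegral.integral_comp_mul_left (fun t : ℝ =>
    Complex.exp (((-k : ℝ) : ℂ) * t * Complex.I) * (symbolDensity p α t : ℂ)) h2π,
    Complex.real_smul, one_div]
  push_cast
  congr 1
  have h := intervalIntegral.integral_comp_add_right (a := -Real.pi) (b := Real.pi) (fun t : ℝ =>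
    Complex.exp (((-k : ℝ) : ℂ) * t * Complex.I) * (symbolDensity p α t : ℂ)) (2 * l * Real.pi)
  rw [show -Real.pi + 2 * l * Real.pi = 2 * Real.pi * (-(1 / 2) + l) by ring,
    show Real.pi + 2 * l * Real.pi = 2 * Real.pi * (-(1 / 2) + l + 1) by ring] at h
  push_cast at h
  rw [← h]
  refine intervalIntegral.integral_congr fun θ _ => ?_
  rw [symbolTerm_eq_symbolDensity, mul_comm]
  congr 1
  rw [Complex.exp_eq_exp_iff_exists_int]
  refine ⟨k * l, ?_⟩
  push_cast
  ring

lemma fourierCoeff_fSymbol {p : ℕ} {α : ℝ} (hα : 0 ≤ α) (hαp : α < p) (k : ℤ) :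
    (1 / (2 * (Real.pi : ℂ))) * ∫ θ in (-Real.pi)..Real.pi,
        (fSymbol p α θ : ℂ) * Complex.exp (-(Complex.I * k * θ)) =
      (1 / (2 * Real.pi)) * ∫ t : ℝ, Complex.exp (((-k : ℝ) : ℂ) * t * Complex.I) *
        (symbolDensity p α t : ℂ) := by
  have h2π : 2 * Real.pi ≠ 0 := by positivity
  have hπ : -Real.pi ≤ Real.pi := by linarith [Real.pi_pos]
  have hsub : ∀ θ ∈ uIoc (-Real.pi) Real.pi, θ ∈ Icc (-Real.pi) Real.pi := by
    intro θ hθ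
    rw [uIoc_of_le hπ] at hθ
    exact Ioc_subset_Icc_self hθ
  have hexp : ∀ θ : ℝ, ‖Complex.exp (-(Complex.I * k * θ))‖ = 1 := by
    intro θ
    have := norm_cexp_mul_mul_I (-k) θ
    push_cast at this
    rw [← this]
    congr 2
    ring
  have h1 : HasSum (fun l : ℤ => ∫ θ in (-Real.pi)..Real.pi,
      (symbolTerm p α θ l : ℂ) * Complex.exp (-(Complex.I * k * θ)))
      (∫ θ in (-Real.pi)..Real.pi, (fSymbol p α θ : ℂ) * Complex.exp (-(Complex.I * k * θ))) := by
    refine intervalIntegral.hasSum_integral_of_dominated_convergence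
      (fun l _ => (4 : ℝ) ^ (p + 1) * (1 + |(l : ℝ)|) ^ (-(p + 1 - α))) ?_ ?_ ?_ ?_ ?_
    · intro l
      refine Continuous.aestronglyMeasurable (Continuous.mul ?_ (by fun_prop))
      exact Complex.continuous_ofReal.comp (continuous_symbolTerm p hα l)
    · refine fun l => Eventually.of_forall fun θ hθ => ?_
      rw [norm_mul, hexp, mul_one, Complex.norm_real]
      exact norm_symbolTerm_le hα hαp (hsub θ hθ) l
    · exact Eventually.of_forall fun _ _ => summable_symbolTerm_bound hαp
    · exact intervalIntegrable_const
    · refine Eventually.of_forall fun θ hθ => ?_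
      exact (Complex.hasSum_ofReal.2 (hasSum_symbolTerm hα hαp (hsub θ hθ))).mul_right _
  have h2 := h1.mul_left (1 / (2 * (Real.pi : ℂ)))
  simp_rw [integral_symbolTerm_mul_cexp] at h2
  have h3 := ((integrable_cexp_mul_symbolDensity (p := p) hα hαp (-k)).comp_mul_left'
    h2π).hasSum_intervalIntegral (-(1 / 2))
  have h4 := h2.unique h3
  rw [h4, Measure.integral_comp_mul_left (fun t : ℝ =>
    Complex.exp (((-k : ℝ) : ℂ) * t * Complex.I) * (symbolDensity p α t : ℂ)),
    abs_of_pos (by positivity), Complex.real_smul, one_div]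
  push_cast
  rfl

lemma cot_half_sub_cot {w : ℂ} (hw : Complex.sin (2 * w) ≠ 0) :
    Complex.cot w - Complex.cot (2 * w) = 1 / Complex.sin (2 * w) := by
  have h := hw
  rw [Complex.sin_two_mul] at h
  have hs : Complex.sin w ≠ 0 := fun h0 => h (by simp [h0])
  have hc : Complex.cos w ≠ 0 := fun h0 => h (by simp [h0])
  rw [Complex.cot_eq_cos_div_sin, Complex.cot_eq_cos_div_sin, Complex.sin_two_mul,
    Complex.cos_two_mul]
  field_simp
  ring

lemma hasSum_alternating_cotTerm {z : ℂ} (hz : z ∈ Complex.integerComplement) :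
    HasSum (fun n : ℕ => (-1 : ℂ) ^ (n + 1) * (1 / (z - (n + 1)) + 1 / (z + (n + 1))))
      (Real.pi / Complex.sin (Real.pi * z) - 1 / z) := by
  have hz2 : z / 2 ∈ Complex.integerComplement := by
    rintro ⟨n, hn⟩
    exact hz ⟨2 * n, by push_cast; rw [hn]; ring⟩
  have hz0 : z ≠ 0 := Complex.integerComplement.ne_zero hz
  set a : ℕ → ℂ := fun n => 1 / (z - (n + 1)) + 1 / (z + (n + 1)) with ha
  have h1 : HasSum a (Real.pi * Complex.cot (Real.pi * z) - 1 / z) := by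
    rw [cot_series_rep' hz]
    exact (summable_cotTerm hz).hasSum
  have h2 : HasSum (fun m : ℕ => 2 * a (2 * m + 1))
      (Real.pi * Complex.cot (Real.pi * (z / 2)) - 1 / (z / 2)) := by
    rw [cot_series_rep' hz2]
    convert! (summable_cotTerm hz2).hasSum using 1
    ext m
    have e1 : z / 2 - (m + 1) = (z - ((2 * m + 1 : ℕ) + 1)) / 2 := by push_cast; ring
    have e2 : z / 2 + (m + 1) = (z + ((2 * m + 1 : ℕ) + 1)) / 2 := by push_cast; ring
    simp only [ha, cotTerm, e1, e2, one_div_div]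
    ring
  have hinj : Function.Injective fun m : ℕ => 2 * m + 1 := fun a b h => by
    simpa using h
  have h3 : HasSum (fun n : ℕ => if Odd n then 2 * a n else 0)
      (Real.pi * Complex.cot (Real.pi * (z / 2)) - 1 / (z / 2)) := by
    rw [← hinj.hasSum_iff]
    · convert! h2 using 1
      ext m
      simp
    · intro n hn
      rw [if_neg]
      rintro ⟨m, rfl⟩
      exact hn ⟨m, rfl⟩
  have h4 := h3.sub h1
  have hsin : Complex.sin (2 * (Real.pi * (z / 2))) ≠ 0 := by
    rw [show 2 * ((Real.pi : ℂ) * (z / 2)) = Real.pi * z by ring]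
    exact sin_pi_mul_ne_zero hz
  have hcot := cot_half_sub_cot hsin
  rw [show 2 * ((Real.pi : ℂ) * (z / 2)) = Real.pi * z by ring] at hcot
  convert! h4 using 1
  · ext n
    rcases Nat.even_or_odd n with hn | hn
    · rw [if_neg (Nat.not_odd_iff_even.2 hn), hn.add_one.neg_one_pow]
      ring
    · rw [if_pos hn, hn.add_one.neg_one_pow]
      ring
  · rw [div_eq_mul_one_div (Real.pi : ℂ), ← hcot]
    field_simp
    ring

lemma tendsto_sum_Icc_csc {z : ℂ} (hz : z ∈ Complex.integerComplement) :
    Tendsto (fun N : ℕ => ∑ l ∈ Finset.Icc (-(N : ℤ)) N, (-1 : ℂ) ^ l / (z + l)) atTop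
      (𝓝 (Real.pi / Complex.sin (Real.pi * z))) := by
  have h := (hasSum_alternating_cotTerm hz).tendsto_sum_nat.const_add (1 / z)
  rw [add_sub_cancel] at h
  refine h.congr fun N => ?_
  induction N with
  | zero => simp
  | succ N ih =>
    have hs := Finset.sum_Icc_succ_eq_add_endpoints
      (fun l : ℤ => (-1 : ℂ) ^ l / (z + l)) (N := N)
    push_cast at hs ⊢
    rw [Finset.sum_range_succ, ← add_assoc, ih, hs]
    have e1 : (-1 : ℂ) ^ ((N : ℤ) + 1) = (-1) ^ (N + 1) := by
      exact_mod_cast zpow_natCast (-1 : ℂ) (N + 1)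
    have e2 : (-1 : ℂ) ^ (-1 + -(N : ℤ)) = (-1) ^ (N + 1) := by
      rw [show -1 + -(N : ℤ) = -((N + 1 : ℕ) : ℤ) by push_cast; ring, zpow_neg, zpow_natCast,
        ← inv_pow]
      norm_num
    simp only [e1, e2, neg_add_rev]
    ring

lemma hasSum_symmetricIcc_symbolTerm_two_two {θ : ℝ} (hθ : θ ∈ Icc (-Real.pi) Real.pi) :
    HasSum (symbolTerm 2 2 θ) (4 * Real.sin (θ / 2) ^ 2) (SummationFilter.symmetricIcc ℤ) := by
  have hπ := Real.pi_pos
  rcases eq_or_ne θ 0 with rfl | h0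
  · have : symbolTerm 2 2 0 = fun _ => 0 := by
      ext l
      unfold symbolTerm
      rcases eq_or_ne l 0 with rfl | hl
      · simp
      · have hne : (0 : ℝ) / 2 + l * Real.pi ≠ 0 := by
          rw [zero_div, zero_add]
          exact mul_ne_zero (Int.cast_ne_zero.2 hl) hπ.ne'
        rw [Real.sinc_of_ne_zero hne, zero_div, zero_add, zero_add, Real.sin_int_mul_pi]
        simp
    rw [this]
    simp
  have hz : ((θ / (2 * Real.pi) : ℝ) : ℂ) ∈ Complex.integerComplement := by
    rintro ⟨n, hn⟩
    have hn' : (n : ℝ) = θ / (2 * Real.pi) := by exact_mod_cast hn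
    rw [eq_div_iff (by positivity)] at hn'
    have h1 : (n : ℝ) < 1 := by
      by_contra hc
      nlinarith [hθ.2]
    have h2 : -1 < (n : ℝ) := by
      by_contra hc
      nlinarith [hθ.1]
    have h3 : n < 1 := by exact_mod_cast h1
    have h4 : -1 < n := by exact_mod_cast h2
    have : n = 0 := by omega
    rw [this] at hn'
    simp at hn'
    exact h0 hn'.symm
  have hsin : Real.sin (θ / 2) ≠ 0 := by
    have := sin_pi_mul_ne_zero hz
    rw [← Complex.ofReal_mul, ← Complex.ofReal_sin,
      show Real.pi * (θ / (2 * Real.pi)) = θ / 2 by field_simp] at this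
    exact_mod_cast this
  have hterm : ∀ l : ℤ, symbolTerm 2 2 θ l =
      4 * Real.sin (θ / 2) ^ 3 / Real.pi * ((-1) ^ l / (θ / (2 * Real.pi) + l)) := by
    intro l
    have hne : θ / (2 * Real.pi) + l ≠ 0 := by
      have := Complex.integerComplement_add_ne_zero hz l
      exact_mod_cast this
    have e : θ / 2 + l * Real.pi = Real.pi * (θ / (2 * Real.pi) + l) := by field_simp
    have hne' : θ / 2 + l * Real.pi ≠ 0 := by
      rw [e]
      exact mul_ne_zero hπ.ne' hne
    have e' : θ + 2 * l * Real.pi = 2 * (θ / 2 + l * Real.pi) := by ring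
    unfold symbolTerm
    rw [Real.sinc_of_ne_zero hne', Real.sin_add_int_mul_pi, Real.rpow_two, sq_abs, e', e]
    have hsq : ((-1 : ℝ) ^ l) ^ 3 = (-1) ^ l := by
      rcases Int.even_or_odd l with hl | hl
      · simp [hl.neg_one_zpow]
      · rw [hl.neg_one_zpow]
        norm_num
    generalize θ / (2 * Real.pi) + l = y at hne ⊢
    rw [div_pow, mul_pow ((-1 : ℝ) ^ l), hsq]
    field_simp
    ring
  rw [SummationFilter.hasSum_symmetricIcc_iff]
  simp_rw [hterm, ← Finset.mul_sum]
  have ht := tendsto_sum_Icc_csc hz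
  have ht' : Tendsto (fun N : ℕ => ∑ l ∈ Finset.Icc (-(N : ℤ)) N,
      (-1 : ℝ) ^ l / (θ / (2 * Real.pi) + l)) atTop (𝓝 (Real.pi / Real.sin (θ / 2))) := by
    rw [← tendsto_ofReal_iff]
    convert! ht using 2
    · push_cast
      rfl
    · push_cast
      congr 2
      field_simp
  convert! ht'.const_mul (4 * Real.sin (θ / 2) ^ 3 / Real.pi) using 2
  field_simp

lemma fSymbol_two_two {θ : ℝ} (hθ : θ ∈ Icc (-Real.pi) Real.pi) :
    fSymbol 2 2 θ = 4 * Real.sin (θ / 2) ^ 2 :=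
  (hasSum_symmetricIcc_symbolTerm_two_two hθ).tsum_eq

lemma intervalIntegrable_fSymbol_two_two :
    IntervalIntegrable (fSymbol 2 2) volume (-Real.pi) Real.pi := by
  refine ContinuousOn.intervalIntegrable ?_
  rw [uIcc_of_le (by linarith [Real.pi_pos])]
  have : Continuous fun θ : ℝ => 4 * Real.sin (θ / 2) ^ 2 := by fun_prop
  exact this.continuousOn.congr fun θ hθ => fSymbol_two_two hθ

lemma integral_cexp_neg_I_mul_int (n : ℤ) :
    (1 / (2 * (Real.pi : ℂ))) * ∫ θ in (-Real.pi)..Real.pi, Complex.exp (-(Complex.I * n * θ)) =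
      if n = 0 then 1 else 0 := by
  have hπ : (Real.pi : ℂ) ≠ 0 := Complex.ofReal_ne_zero.2 Real.pi_ne_zero
  split_ifs with h
  · subst h
    simp
    field_simp
    norm_num
  · have hc : -(Complex.I * n) ≠ 0 :=
      neg_ne_zero.2 (mul_ne_zero Complex.I_ne_zero (Int.cast_ne_zero.2 h))
    have := integral_exp_mul_complex (a := -Real.pi) (b := Real.pi) hc
    simp only [neg_mul] at this
    rw [this, sub_eq_zero.2, zero_div, mul_zero]
    rw [Complex.exp_eq_exp_iff_exists_int]
    refine ⟨-n, ?_⟩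
    push_cast
    ring

lemma fourierCoeff_fSymbol_two_two (k : ℤ) :
    (1 / (2 * (Real.pi : ℂ))) * ∫ θ in (-Real.pi)..Real.pi,
        (fSymbol 2 2 θ : ℂ) * Complex.exp (-(Complex.I * k * θ)) =
      2 * (if k = 0 then 1 else 0) - (if k - 1 = 0 then 1 else 0) -
        (if k + 1 = 0 then 1 else 0) := by
  have hi : ∀ n : ℤ, IntervalIntegrable (fun θ : ℝ => Complex.exp (-(Complex.I * n * θ))) volume
      (-Real.pi) Real.pi := fun n => Continuous.intervalIntegrable (by fun_prop) _ _
  have h1 : ∫ θ in (-Real.pi)..Real.pi,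
        (fSymbol 2 2 θ : ℂ) * Complex.exp (-(Complex.I * k * θ)) =
      ∫ θ in (-Real.pi)..Real.pi, (2 * Complex.exp (-(Complex.I * k * θ)) -
        Complex.exp (-(Complex.I * (k - 1 : ℤ) * θ)) -
        Complex.exp (-(Complex.I * (k + 1 : ℤ) * θ))) := by
    refine intervalIntegral.integral_congr fun θ hθ => ?_
    rw [uIcc_of_le (by linarith [Real.pi_pos])] at hθ
    rw [fSymbol_two_two hθ]
    have e1 : Complex.exp (-(Complex.I * (k - 1 : ℤ) * θ)) =
        Complex.exp (θ * Complex.I) * Complex.exp (-(Complex.I * k * θ)) := by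
      rw [← Complex.exp_add]
      congr 1
      push_cast
      ring
    have e2 : Complex.exp (-(Complex.I * (k + 1 : ℤ) * θ)) =
        Complex.exp (-θ * Complex.I) * Complex.exp (-(Complex.I * k * θ)) := by
      rw [← Complex.exp_add]
      congr 1
      push_cast
      ring
    have e3 : (4 * Real.sin (θ / 2) ^ 2 : ℝ) = 2 - 2 * Real.cos θ := by
      rw [Real.sin_sq, Real.cos_sq, mul_div_cancel₀ _ two_ne_zero]
      ring
    rw [e1, e2, e3]
    push_cast
    rw [Complex.cos]
    ring
  rw [h1, intervalIntegral.integral_sub (((hi k).const_mul 2).sub (hi _)) (hi _),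
    intervalIntegral.integral_sub ((hi k).const_mul 2) (hi _),
    intervalIntegral.integral_const_mul, mul_sub, mul_sub, mul_left_comm,
    integral_cexp_neg_I_mul_int, integral_cexp_neg_I_mul_int, integral_cexp_neg_I_mul_int]

lemma fracBSpline_two_two (x : ℝ) :
    fracBSpline 2 2 x = (if 0 < x then 1 else 0) - 3 * (if 1 < x then 1 else 0) +
      3 * (if 2 < x then 1 else 0) - (if 3 < x then 1 else 0) := by
  simp only [fracBSpline, truncPow, Finset.sum_range_succ, Finset.sum_range_zero]
  norm_num [Nat.choose]
  split_ifs <;> norm_num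

lemma fracBSpline_two_two_add_reflect (k : ℤ) :
    fracBSpline 2 2 (3 / 2 - k) + fracBSpline 2 2 (3 / 2 + k) =
      -2 * (2 * (if k = 0 then 1 else 0) - (if k - 1 = 0 then 1 else 0) -
        (if k + 1 = 0 then 1 else 0)) := by
  rw [fracBSpline_two_two, fracBSpline_two_two]
  rcases lt_trichotomy k 0 with h | rfl | h
  · rcases eq_or_lt_of_le (show k ≤ -1 by omega) with rfl | h'
    · norm_num
    · have hk : (k : ℝ) ≤ -2 := by exact_mod_cast (show k ≤ -2 by omega)
      rw [if_pos (by linarith), if_pos (by linarith), if_pos (by linarith), if_pos (by linarith),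
        if_neg (by linarith), if_neg (by linarith), if_neg (by linarith), if_neg (by linarith),
        if_neg (by omega), if_neg (by omega), if_neg (by omega)]
      norm_num
  · norm_num
  · rcases eq_or_lt_of_le (show 1 ≤ k by omega) with rfl | h'
    · norm_num
    · have hk : (2 : ℝ) ≤ k := by exact_mod_cast (show 2 ≤ k by omega)
      rw [if_neg (by linarith), if_neg (by linarith), if_neg (by linarith), if_neg (by linarith),
        if_pos (by linarith), if_pos (by linarith), if_pos (by linarith), if_pos (by linarith),
        if_neg (by omega), if_neg (by omega), if_neg (by omega)]
      norm_num

lemma fracDerivLeft_add_fracDerivRight {p : ℕ} {α y : ℝ} (hαp : α ≤ p)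
    (h : α < p ∨ ((p : ℝ) + 1) / 2 - y ∉ range ((↑) : ℤ → ℝ)) :
    fracDerivLeft α (cardinalBSpline p) (((p : ℝ) + 1) / 2 - y) +
        fracDerivRight α (cardinalBSpline p) (((p : ℝ) + 1) / 2 - y) =
      fracBSpline p α (((p : ℝ) + 1) / 2 - y) + fracBSpline p α (((p : ℝ) + 1) / 2 + y) := by
  have e : (p : ℝ) + 1 - (((p : ℝ) + 1) / 2 - y) = ((p : ℝ) + 1) / 2 + y := by ring
  have h' : α < p ∨ ((p : ℝ) + 1) / 2 + y ∉ range ((↑) : ℤ → ℝ) := by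
    refine h.imp_right ?_
    rintro hx ⟨n, hn⟩
    exact hx ⟨p + 1 - n, by push_cast; linarith⟩
  rw [fracDerivRight_cardinalBSpline, e,
    (rlIntegralLeft_contDiffAt_and_fracDerivLeft hαp h).2,
    (rlIntegralLeft_contDiffAt_and_fracDerivLeft hαp h').2]
  rfl

lemma three_halves_sub_int_notMem_range_intCast (k : ℤ) :
    (((2 : ℕ) : ℝ) + 1) / 2 - k ∉ range ((↑) : ℤ → ℝ) := by
  rintro ⟨n, hn⟩
  have h : (2 * (n + k) : ℝ) = 3 := by
    push_cast at hn
    linarith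
  have h' : 2 * (n + k) = 3 := by exact_mod_cast h
  omega

lemma cos_pi_mul_div_two_ne_zero {α : ℝ} (hα : α ∈ Ico (0 : ℝ) 1 ∪ Ioc (1 : ℝ) 2) :
    Real.cos (Real.pi * α / 2) ≠ 0 := by
  have hπ := Real.pi_pos
  rcases hα with ⟨h0, h1⟩ | ⟨h1, h2⟩
  · exact (Real.cos_pos_of_mem_Ioo ⟨by nlinarith, by nlinarith⟩).ne'
  · exact (Real.cos_neg_of_pi_div_two_lt_of_lt (by nlinarith) (by nlinarith)).ne

theorem stmt5 (p : ℕ) (hp : 2 ≤ p) (α : ℝ)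
    (hα : α ∈ Set.Ico (0 : ℝ) 1 ∪ Set.Ioc (1 : ℝ) 2) :
    -- the series defining the symbol converges, absolutely when `α < p`
    (∀ θ ∈ Set.Icc (-Real.pi) Real.pi,
      HasSum (symbolTerm p α θ) (fSymbol p α θ) (SummationFilter.symmetricIcc ℤ)) ∧
    (α < p → ∀ θ ∈ Set.Icc (-Real.pi) Real.pi, HasSum (symbolTerm p α θ) (fSymbol p α θ)) ∧
    -- the symbol is integrable, so that its Fourier coefficients make sense
    IntervalIntegrable (fSymbol p α) MeasureTheory.volume (-Real.pi) Real.pi ∧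
    ∀ k : ℤ,
      -- the derivatives in the two fractional derivatives exist at `(p + 1) / 2 - k`
      ContDiffAt ℝ (rlOrder α) (rlIntegralLeft α (cardinalBSpline p))
        (((p : ℝ) + 1) / 2 - (k : ℝ)) ∧
      ContDiffAt ℝ (rlOrder α) (rlIntegralRight α (cardinalBSpline p))
        (((p : ℝ) + 1) / 2 - (k : ℝ)) ∧
      (1 / (2 * (Real.pi : ℂ))) *
          ∫ θ in (-Real.pi)..Real.pi,
            (fSymbol p α θ : ℂ) * Complex.exp (-(Complex.I * (k : ℂ) * (θ : ℂ)))
        = (((1 / (2 * Real.cos (Real.pi * α / 2)))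
            * (fracDerivLeft α (cardinalBSpline p) (((p : ℝ) + 1) / 2 - (k : ℝ))
              + fracDerivRight α (cardinalBSpline p) (((p : ℝ) + 1) / 2 - (k : ℝ))) : ℝ) : ℂ) := by
  have hα0 : 0 ≤ α := by
    rcases hα with h | h
    · exact h.1
    · linarith [h.1]
  have hα2 : α ≤ 2 := by
    rcases hα with h | h
    · linarith [h.2]
    · exact h.2
  have hp2 : (2 : ℝ) ≤ p := by exact_mod_cast hp
  have hαp : α ≤ p := hα2.trans hp2
  have hcos := cos_pi_mul_div_two_ne_zero hα
  rcases hαp.lt_or_eq with hlt | heq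
  · refine ⟨fun θ hθ => hasSum_symmetricIcc_symbolTerm hα0 hlt hθ,
      fun _ θ hθ => hasSum_symbolTerm hα0 hlt hθ, intervalIntegrable_fSymbol hα0 hlt,
      fun k => ⟨(rlIntegralLeft_contDiffAt_and_fracDerivLeft hαp (Or.inl hlt)).1,
        rlIntegralRight_contDiffAt hαp (Or.inl hlt), ?_⟩⟩
    have h1 := fracBSpline_add_reflect_eq_integral (p := p) hα0 hlt (-k : ℝ)
    rw [sub_neg_eq_add, ← sub_eq_add_neg] at h1
    have hcos' : ((2 * Real.cos (Real.pi * α / 2) : ℝ) : ℂ) ≠ 0 :=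
      Complex.ofReal_ne_zero.2 (mul_ne_zero two_ne_zero hcos)
    rw [fourierCoeff_fSymbol hα0 hlt k, fracDerivLeft_add_fracDerivRight hαp (Or.inl hlt),
      Complex.ofReal_mul, h1, Complex.ofReal_div, Complex.ofReal_one, ← mul_assoc,
      one_div_mul_cancel hcos', one_mul]
  · obtain rfl : α = 2 := by linarith
    obtain rfl : p = 2 := by exact_mod_cast heq.symm
    refine ⟨fun θ hθ => ?_, fun h => absurd h (by simp), intervalIntegrable_fSymbol_two_two,
      fun k => ?_⟩
    · rw [fSymbol_two_two hθ]
      exact hasSum_symmetricIcc_symbolTerm_two_two hθ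
    have hk := three_halves_sub_int_notMem_range_intCast k
    refine ⟨(rlIntegralLeft_contDiffAt_and_fracDerivLeft hαp (Or.inr hk)).1,
      rlIntegralRight_contDiffAt hαp (Or.inr hk), ?_⟩
    rw [fourierCoeff_fSymbol_two_two, fracDerivLeft_add_fracDerivRight hαp (Or.inr hk)]
    have h := fracBSpline_two_two_add_reflect k
    rw [show (((2 : ℕ) : ℝ) + 1) / 2 = 3 / 2 by norm_num, h,
      show Real.pi * 2 / 2 = Real.pi by ring, Real.cos_pi]
    push_cast [apply_ite Complex.ofReal]
    ring
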